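/- For V = ℚ², every linear map V → V^{⊗4} is a finite sum of brackets [D₁,D₂] with D₁ : V → V^{⊗2} and D₂ : V → V^{⊗3} linear; in particular the weight-3 part of the abelianization of Der⁺(T(V)) vanishes. -/

import Mathlib

/- Coordinate model of `V = ℚ²` and its tensor powers: `TV m` is the coordinate model of
`V^{⊗m}` (coordinates w.r.t. the standard basis tensors). -/

abbrev V2 := Fin 2 → ℚ
abbrev TV (m : ℕ) := (Fin m → Fin 2) → ℚ

/-- The unique extension of `D : V → V^{⊗(k+1)}` to a derivation of the tensor algebra,
restricted to a map `V^{⊗m} → V^{⊗(m+k)}` (in coordinates): on decomposables it is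
`u₁⊗⋯⊗u_m ↦ Σ_p u₁⊗⋯⊗D(u_p)⊗⋯⊗u_m`. -/
def ext (k m : ℕ) (D : V2 →ₗ[ℚ] TV (k+1)) : TV m →ₗ[ℚ] TV (m+k) where
  toFun t := fun ψ =>
    ∑ p : Fin m, ∑ c : Fin 2,
      D (Pi.single c 1) (fun r : Fin (k+1) => ψ ⟨p.1 + r.1, by have := p.2; have := r.2; omega⟩)
        * t (fun q : Fin m =>
            if q.1 < p.1 then ψ ⟨q.1, by have := q.2; omega⟩
            else if q = p then c
            else ψ ⟨q.1 + k, by have := q.2; omega⟩)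
  map_add' t t' := by
    funext ψ
    simp only [Pi.add_apply]
    rw [← Finset.sum_add_distrib]
    refine Finset.sum_congr rfl fun p _ => ?_
    rw [← Finset.sum_add_distrib]
    refine Finset.sum_congr rfl fun c _ => ?_
    ring
  map_smul' a t := by
    funext ψ
    simp only [Pi.smul_apply, smul_eq_mul, RingHom.id_apply]
    rw [Finset.mul_sum]
    refine Finset.sum_congr rfl fun p _ => ?_
    rw [Finset.mul_sum]
    refine Finset.sum_congr rfl fun c _ => ?_
    ring

/-- the bracket `[D₁, D₂]` of `D₁ : V → V^{⊗2}` and `D₂ : V → V^{⊗3}`, i.e. the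
restriction to `V` of `D̃₁ ∘ D̃₂ - D̃₂ ∘ D̃₁`. -/
def brkt12 (D₁ : V2 →ₗ[ℚ] TV 2) (D₂ : V2 →ₗ[ℚ] TV 3) : V2 →ₗ[ℚ] TV 4 :=
  (ext 1 3 D₁) ∘ₗ D₂ - (ext 2 2 D₂) ∘ₗ D₁

/-- The elementary map `V → V^{⊗m}` sending the basis vector `e_c` to the basis tensor `e_w`
and the other basis vector to `0`. -/
def elementary {m : ℕ} (c : Fin 2) (w : Fin m → Fin 2) : V2 →ₗ[ℚ] TV m :=
  (LinearMap.proj c).smulRight fun u => if u = w then 1 else 0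

/-- The subspace of maps `V → V^{⊗4}` spanned by the brackets. -/
def brktSpan : Submodule ℚ (V2 →ₗ[ℚ] TV 4) :=
  Submodule.span ℚ {E | ∃ D₁ D₂, brkt12 D₁ D₂ = E}

theorem brkt12_mem_brktSpan (D₁ : V2 →ₗ[ℚ] TV 2) (D₂ : V2 →ₗ[ℚ] TV 3) :
    brkt12 D₁ D₂ ∈ brktSpan :=
  Submodule.subset_span ⟨D₁, D₂, rfl⟩

theorem linearMap_ext_coord {m : ℕ} {D D' : V2 →ₗ[ℚ] TV m}
    (h : ∀ c w, D (Pi.single c 1) w = D' (Pi.single c 1) w) : D = D' :=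
  (Pi.basisFun ℚ (Fin 2)).ext fun c => by
    simpa only [Pi.basisFun_apply] using funext (h c)

theorem eq_sum_elementary {m : ℕ} (D : V2 →ₗ[ℚ] TV m) :
    D = ∑ c, ∑ w, D (Pi.single c 1) w • elementary c w := by
  refine linearMap_ext_coord fun d u => ?_
  simp only [elementary, LinearMap.sum_apply, Finset.sum_apply, LinearMap.smul_apply, Pi.smul_apply,
    LinearMap.smulRight_apply, LinearMap.proj_apply, Pi.single_apply, smul_eq_mul]
  rw [Finset.sum_eq_single d (fun c _ hc => by simp [hc]) (by simp)]
  simp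

theorem ext_smul (k m : ℕ) (a : ℚ) (D : V2 →ₗ[ℚ] TV (k + 1)) :
    ext k m (a • D) = a • ext k m D := by
  refine LinearMap.ext fun t => funext fun ψ => ?_
  simp [ext, Finset.mul_sum, mul_add, mul_assoc]

theorem brkt12_smul (a : ℚ) (D₁ : V2 →ₗ[ℚ] TV 2) (D₂ : V2 →ₗ[ℚ] TV 3) :
    brkt12 D₁ (a • D₂) = a • brkt12 D₁ D₂ := by
  rw [brkt12, brkt12, ext_smul, LinearMap.comp_smul, LinearMap.smul_comp, smul_sub]

/-- For `{x, y} = {0, 1}`, each elementary map `x ↦ w` with `w` a word of length four is a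
signed sum of at most two brackets of elementary maps. -/
theorem elementary_eq_brkt12 (x y : Fin 2) (hxy : x ≠ y) :
    (elementary x ![x, x, x, x] =
      brkt12 (elementary x ![x, x]) (elementary x ![x, x, x])) ∧
    (elementary x ![x, x, x, y] =
      brkt12 (elementary y ![x, y]) (elementary x ![x, x, y]) +
      brkt12 (elementary x ![x, x]) (elementary y ![x, y, y])) ∧
    (elementary x ![x, x, y, x] =
      brkt12 (elementary y ![x, y]) (elementary x ![x, y, x]) +
      brkt12 (elementary y ![x, y]) (elementary y ![x, y, y])) ∧
    (elementary x ![x, x, y, y] =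
      brkt12 (elementary y ![y, y]) (elementary x ![x, x, y])) ∧
    (elementary x ![x, y, x, x] =
      brkt12 (elementary y ![y, x]) (elementary x ![x, y, x]) +
      brkt12 (elementary y ![y, x]) (elementary y ![y, y, x])) ∧
    (elementary x ![x, y, x, y] =
      brkt12 (elementary x ![x, y]) (elementary x ![x, x, y])) ∧
    (elementary x ![x, y, y, x] =
      brkt12 (elementary x ![y, x]) (elementary x ![x, y, x])) ∧
    (elementary x ![x, y, y, y] =
      -brkt12 (elementary x ![x, y]) (elementary y ![y, y, y])) ∧
    (elementary x ![y, x, x, x] =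
      brkt12 (elementary y ![y, x]) (elementary x ![y, x, x]) +
      brkt12 (elementary x ![x, x]) (elementary y ![y, y, x])) ∧
    (elementary x ![y, x, x, y] =
      brkt12 (elementary y ![x, y]) (elementary x ![y, x, y]) +
      brkt12 (elementary x ![x, y]) (elementary y ![y, x, y])) ∧
    (elementary x ![y, x, y, x] =
      brkt12 (elementary x ![y, x]) (elementary x ![y, x, x])) ∧
    (elementary x ![y, x, y, y] =
      brkt12 (elementary x ![y, y]) (elementary x ![y, x, x]) +
      brkt12 (elementary x ![y, x]) (elementary y ![y, y, y])) ∧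
    (elementary x ![y, y, x, x] =
      brkt12 (elementary y ![y, y]) (elementary x ![y, x, x])) ∧
    (elementary x ![y, y, x, y] =
      brkt12 (elementary x ![y, y]) (elementary x ![x, x, y]) +
      brkt12 (elementary x ![x, y]) (elementary y ![y, y, y])) ∧
    (elementary x ![y, y, y, x] =
      -brkt12 (elementary x ![y, x]) (elementary y ![y, y, y])) ∧
    (elementary x ![y, y, y, y] =
      -brkt12 (elementary x ![y, x]) (elementary x ![y, y, y])) := by
  refine ⟨?_, ?_, ?_, ?_, ?_, ?_, ?_, ?_, ?_, ?_, ?_, ?_, ?_, ?_, ?_, ?_⟩ <;>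
    refine linearMap_ext_coord ?_ <;> revert x y <;> decide +kernel

theorem elementary_mem_brktSpan (x : Fin 2) (w : Fin 4 → Fin 2) :
    elementary x w ∈ brktSpan := by
  obtain ⟨y, hxy⟩ : ∃ y, x ≠ y := (exists_ne x).imp fun _ h => h.symm
  have hw : ∀ i, w i = x ∨ w i = y := fun i => by lia
  have hvec : w = ![w 0, w 1, w 2, w 3] := by
    funext i
    fin_cases i <;> rfl
  obtain ⟨h0, h1, h2, h3, h4, h5, h6, h7, h8, h9, h10, h11, h12, h13, h14, h15⟩ :=
    elementary_eq_brkt12 x y hxy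
  have hadd (D₁ D₁' D₂ D₂') : brkt12 D₁ D₂ + brkt12 D₁' D₂' ∈ brktSpan :=
    add_mem (brkt12_mem_brktSpan D₁ D₂) (brkt12_mem_brktSpan D₁' D₂')
  have hneg (D₁ D₂) : -brkt12 D₁ D₂ ∈ brktSpan := neg_mem (brkt12_mem_brktSpan D₁ D₂)
  rw [hvec]
  rcases hw 0 with e0 | e0 <;> rcases hw 1 with e1 | e1 <;> rcases hw 2 with e2 | e2 <;>
    rcases hw 3 with e3 | e3 <;> rw [e0, e1, e2, e3] <;>
    simp only [h0, h1, h2, h3, h4, h5, h6, h7, h8, h9, h10, h11, h12, h13, h14, h15,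
      brkt12_mem_brktSpan, hadd, hneg]

/-- for `V = ℚ²`, every linear map `V → V^{⊗4}` is a finite sum of brackets
`[D₁,D₂]` with `D₁ : V → V^{⊗2}` and `D₂ : V → V^{⊗3}`; in particular the weight 3 part of
the abelianization of `Der⁺(T(V))` vanishes. -/
theorem stmt15 (E : V2 →ₗ[ℚ] TV 4) :
    ∃ (n : ℕ) (D₁ : Fin n → (V2 →ₗ[ℚ] TV 2)) (D₂ : Fin n → (V2 →ₗ[ℚ] TV 3)),
      E = ∑ i : Fin n, brkt12 (D₁ i) (D₂ i) := by
  have hE : E ∈ brktSpan := by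
    rw [eq_sum_elementary E]
    exact sum_mem fun c _ => sum_mem fun w _ =>
      Submodule.smul_mem _ _ (elementary_mem_brktSpan c w)
  obtain ⟨n, a, g, h⟩ := Submodule.mem_span_set'.mp hE
  choose D₁ D₂ hD using fun i => (g i).2
  refine ⟨n, D₁, fun i => a i • D₂ i, ?_⟩
  simp only [brkt12_smul, hD, h]
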